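/- Let μ be a probability measure on Γ(ℝⁿ) having correlation functions k_m for 1 ≤ m ≤ M (M ≥ 2 an integer) with ‖k_m‖_∞ ≤ K < ∞ for all such m. Then for every α > 0 and every r with 0 ≤ r ≤ M/2 − 1, the function a_{α,r}(γ) := Σ_{{x,y}⊂γ, |x−y|≤R} e^{−α|x|} [n_{γ,R}(x) n_{γ,R}(y)]^r is μ-integrable, with ∫ a_{α,r} dμ ≤ K · (Σ_{j=1}^{M−1} c_j Vol(B_{2R})^j) · ∫_{ℝⁿ} e^{−α|x|} dx, where c_j are the multinomial coefficients Σ_{i₁+⋯+i_j=M−1, i_k≥1} (M−1)!/(i₁!⋯i_j!). -/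

import Mathlib

open MeasureTheory Set ENNReal Real
open scoped Classical

/-- The space of locally finite configurations in `ℝⁿ`. -/
def Config (n : ℕ) : Type :=
  {γ : Set (EuclideanSpace ℝ (Fin n)) //
    ∀ K : Set (EuclideanSpace ℝ (Fin n)), IsCompact K → (γ ∩ K).Finite}

/-- Degree: number of points `y ∈ γ`, `y ≠ x`, within distance `s` of `x`. -/
noncomputable def confDegree {n : ℕ} (γ : Set (EuclideanSpace ℝ (Fin n))) (s : ℝ)
    (x : EuclideanSpace ℝ (Fin n)) : ℕ :=
  Set.ncard {z ∈ γ | 0 < dist x z ∧ dist x z ≤ s}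

/-- The multinomial coefficient `c_j = ∑_{i₁+⋯+i_j = M-1, i_k ≥ 1} (M-1)!/(i₁!⋯i_j!)`. -/
noncomputable def multCoeff (M j : ℕ) : ℕ :=
  ∑ i ∈ (Finset.Nat.antidiagonalTuple j (M - 1)).filter (fun i => ∀ k, 0 < i k),
    (M - 1).factorial / ∏ k, (i k).factorial

/-- The function `a_{α,r}`, summing `e^{-α|x|} [n_{γ,R}(x) n_{γ,R}(y)]^r` over
pairs of distinct points of `γ` at distance `≤ R`. -/
noncomputable def aFun {n : ℕ} (α R r : ℝ) (γ : Set (EuclideanSpace ℝ (Fin n))) : ℝ≥0∞ :=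
  ∑' x : γ, ∑' y : γ,
    if (x : EuclideanSpace ℝ (Fin n)) ≠ y ∧ dist (x : EuclideanSpace ℝ (Fin n)) (y : EuclideanSpace ℝ (Fin n)) ≤ R
    then ENNReal.ofReal (rexp (-α * ‖(x : EuclideanSpace ℝ (Fin n))‖)) *
      ((confDegree γ R x * confDegree γ R y : ℕ) : ℝ≥0∞) ^ r
    else 0

/-! ### Abstract lower-integral lemmas -/

/-- `φ` is a maximal measurable minorant of `F`. -/
structure IsStar {Ω : Type*} [MeasurableSpace Ω] (μ : Measure Ω) (F φ : Ω → ℝ≥0∞) : Prop where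
  meas : Measurable φ
  le : ∀ ω, φ ω ≤ F ω
  lint : ∫⁻ ω, F ω ∂μ = ∫⁻ ω, φ ω ∂μ
  max : ∀ ψ : Ω → ℝ≥0∞, Measurable ψ → (∀ ω, ψ ω ≤ F ω) → ψ ≤ᵐ[μ] φ

lemma exists_isStar {Ω : Type*} [MeasurableSpace Ω] (μ : Measure Ω) [SigmaFinite μ]
    (F : Ω → ℝ≥0∞) : ∃ φ, IsStar μ F φ := by
  obtain ⟨g, hg, hle, hs⟩ := exists_measurable_le_forall_setLIntegral_eq μ F
  refine ⟨g, hg, hle, ?_, ?_⟩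
  · simpa using hs univ
  · intro ψ hψ hψF
    refine ae_le_of_forall_setLIntegral_le_of_sigmaFinite hψ fun s _ _ => ?_
    rw [← hs s]
    exact lintegral_mono hψF

lemma ae_of_dense {Ω : Type*} [MeasurableSpace Ω] {μ : Measure Ω} {G G' φ ψ : Ω → ℝ≥0∞}
    (hG : IsStar μ G G') (hfin : ∀ᵐ ω ∂μ, G' ω ≠ ∞) (hφ : Measurable φ) (hψ : Measurable ψ)
    (h : ∀ᵐ ω ∂μ, G ω ≤ G' ω + 2⁻¹ → φ ω ≤ ψ ω) : φ ≤ᵐ[μ] ψ := by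
  obtain ⟨T, hTsub, hTm, hT0⟩ := exists_measurable_superset_of_null (ae_iff.1 h)
  let D : Set Ω := {ω | ψ ω < φ ω} ∩ Tᶜ
  have hD : MeasurableSet D := (measurableSet_lt hψ hφ).inter hTm.compl
  have hη : (fun ω => G' ω + D.indicator (fun _ => (2⁻¹ : ℝ≥0∞)) ω) ≤ᵐ[μ] G' := by
    refine hG.max _ (hG.meas.add (measurable_const.indicator hD)) fun ω => ?_
    by_cases hω : ω ∈ D
    · simp only [indicator_of_mem hω]
      by_contra hc
      apply hω.2
      apply hTsub
      simp only [mem_ofPred_eq, Classical.not_imp, not_le]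
      exact ⟨(not_le.1 hc).le, hω.1⟩
    · simpa [indicator_of_notMem hω] using hG.le ω
  have hTae : ∀ᵐ ω ∂μ, ω ∉ T := measure_eq_zero_iff_ae_notMem.1 hT0
  filter_upwards [hη, hfin, hTae] with ω h1 h2 h3
  by_contra hc
  have hω : ω ∈ D := ⟨not_le.1 hc, h3⟩
  simp only [indicator_of_mem hω] at h1
  have : G' ω + 2⁻¹ ≤ G' ω + 0 := by simpa using h1
  have := (ENNReal.add_le_add_iff_left h2).1 this
  simp at this

lemma lintegral_mul_star {X : Type*} [MeasurableSpace X] {ν : Measure X} [SigmaFinite ν]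
    {k k' : X → ℝ≥0∞} (hk : IsStar ν k k') {h : X → ℝ≥0∞} (hh : Measurable h)
    (hfin : ∀ x, h x ≠ ∞) : ∫⁻ x, h x * k x ∂ν = ∫⁻ x, h x * k' x ∂ν := by
  apply le_antisymm
  · obtain ⟨ψ, hψ, hle, heq⟩ := exists_measurable_le_lintegral_eq ν (fun x => h x * k x)
    rw [heq]
    have : (fun x => ψ x / h x) ≤ᵐ[ν] k' := by
      have hm : MeasurableSet {x | h x = 0} := hh (measurableSet_singleton 0)
      have h2 := hk.max ({x | h x = 0}ᶜ.indicator fun x => ψ x / h x)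
        ((hψ.div hh).indicator hm.compl) (fun x => by
          by_cases hx : h x = 0
          · simp [hx]
          · rw [indicator_of_mem (by simpa using hx)]
            apply ENNReal.div_le_of_le_mul
            rw [mul_comm]; exact hle x)
      filter_upwards [h2] with x hx
      by_cases hx0 : h x = 0
      · have : ψ x = 0 := by simpa [hx0] using hle x
        simp [this]
      · rwa [indicator_of_mem (by simpa using hx0)] at hx
    refine lintegral_mono_ae ?_
    filter_upwards [this] with x hx
    by_cases hx0 : h x = 0
    · simpa [hx0] using hle x
    · calc ψ x = h x * (ψ x / h x) := (ENNReal.mul_div_cancel hx0 (hfin x)).symm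
        _ ≤ _ := by gcongr
  · exact lintegral_mono fun x => by gcongr; exact hk.le x

lemma lintegral_add_mul {X : Type*} [MeasurableSpace X] {ν : Measure X} [SigmaFinite ν]
    (k : X → ℝ≥0∞) {h h' : X → ℝ≥0∞} (hh : Measurable h) (hh' : Measurable h')
    (hfin : ∀ x, h x ≠ ∞) (hfin' : ∀ x, h' x ≠ ∞) :
    ∫⁻ x, (h x + h' x) * k x ∂ν = ∫⁻ x, h x * k x ∂ν + ∫⁻ x, h' x * k x ∂ν := by
  obtain ⟨k', hk⟩ := exists_isStar ν k
  rw [lintegral_mul_star hk hh hfin, lintegral_mul_star hk hh' hfin',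
    lintegral_mul_star (h := fun x => h x + h' x) hk (hh.add hh')
      (fun x => ENNReal.add_ne_top.2 ⟨hfin x, hfin' x⟩)]
  simp_rw [add_mul]
  exact lintegral_add_left (hh.mul hk.meas) _

/-! ### Tuple sums -/

/-- Sum of `g` over injective `m`-tuples of points of `γ`. -/
noncomputable def FF {n : ℕ} (m : ℕ) (g : (Fin m → EuclideanSpace ℝ (Fin n)) → ℝ≥0∞)
    (γ : Set (EuclideanSpace ℝ (Fin n))) : ℝ≥0∞ :=
  ∑' t : {t : Fin m → EuclideanSpace ℝ (Fin n) // Function.Injective t ∧ ∀ i, t i ∈ γ}, g t.1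

lemma FF_mono {n m : ℕ} {g g' : (Fin m → EuclideanSpace ℝ (Fin n)) → ℝ≥0∞}
    (h : ∀ t, g t ≤ g' t) (γ : Set (EuclideanSpace ℝ (Fin n))) : FF m g γ ≤ FF m g' γ :=
  ENNReal.tsum_le_tsum fun t => h t.1

lemma FF_add {n m : ℕ} (g g' : (Fin m → EuclideanSpace ℝ (Fin n)) → ℝ≥0∞)
    (γ : Set (EuclideanSpace ℝ (Fin n))) :
    FF m (fun t => g t + g' t) γ = FF m g γ + FF m g' γ := ENNReal.tsum_add

lemma FF_const_mul {n m : ℕ} (c : ℝ≥0∞) (g : (Fin m → EuclideanSpace ℝ (Fin n)) → ℝ≥0∞)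
    (γ : Set (EuclideanSpace ℝ (Fin n))) :
    FF m (fun t => c * g t) γ = c * FF m g γ := ENNReal.tsum_mul_left

lemma tsum_pi_fin {ι : Type*} (w : ι → ℝ≥0∞) (m : ℕ) :
    ∑' t : Fin m → ι, ∏ i, w (t i) = (∑' x, w x) ^ m := by
  induction m with
  | zero => simp
  | succ m ih =>
    rw [← (Fin.consEquiv (fun _ => ι)).tsum_eq, ENNReal.tsum_prod']
    simp only [Fin.consEquiv, Equiv.coe_fn_mk, Fin.prod_univ_succ, Fin.cons_zero, Fin.cons_succ]
    simp_rw [ENNReal.tsum_mul_left, ih, ENNReal.tsum_mul_right]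
    rw [pow_succ']

lemma FF_one {n : ℕ} (w : EuclideanSpace ℝ (Fin n) → ℝ≥0∞)
    (γ : Set (EuclideanSpace ℝ (Fin n))) :
    FF 1 (fun t => w (t 0)) γ = ∑' x : γ, w x := by
  let e : γ ≃ {t : Fin 1 → EuclideanSpace ℝ (Fin n) // Function.Injective t ∧ ∀ i, t i ∈ γ} :=
    { toFun := fun x => ⟨fun _ => x.1, fun _ _ _ => Subsingleton.elim _ _, fun _ => x.2⟩
      invFun := fun t => ⟨t.1 0, t.2.2 0⟩
      left_inv := fun x => rfl
      right_inv := fun t => by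
        apply Subtype.ext; funext i; rw [Subsingleton.elim i 0] }
  exact (e.tsum_eq _).symm

lemma FF_prod_le {n : ℕ} (w : EuclideanSpace ℝ (Fin n) → ℝ≥0∞) (m : ℕ)
    (γ : Set (EuclideanSpace ℝ (Fin n))) :
    FF m (fun t => ∏ i, w (t i)) γ ≤ (FF 1 (fun t => w (t 0)) γ) ^ m := by
  rw [FF_one, ← tsum_pi_fin]
  let f : {t : Fin m → EuclideanSpace ℝ (Fin n) // Function.Injective t ∧ ∀ i, t i ∈ γ} →
    (Fin m → γ) := fun t i => ⟨t.1 i, t.2.2 i⟩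
  have hf : Function.Injective f := fun t t' h => by
    apply Subtype.ext; funext i
    exact congrArg Subtype.val (congrFun h i)
  exact ENNReal.tsum_comp_le_tsum_of_injective hf (fun t => ∏ i, w (t i))

lemma FF_indicator {n : ℕ} (B : Set (EuclideanSpace ℝ (Fin n))) (m : ℕ)
    (γ : Set (EuclideanSpace ℝ (Fin n))) (hfin : (γ ∩ B).Finite) :
    FF m (fun t => if ∀ i, t i ∈ B then 1 else 0) γ
      = (((γ ∩ B).ncard.descFactorial m : ℕ) : ℝ≥0∞) := by
  have : Fintype ↥(γ ∩ B) := hfin.fintype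
  have h1 : FF m (fun t => if ∀ i, t i ∈ B then 1 else 0) γ = ∑' e : Fin m ↪ ↥(γ ∩ B), 1 := by
    unfold FF
    let f : (Fin m ↪ ↥(γ ∩ B)) →
        {t : Fin m → EuclideanSpace ℝ (Fin n) // Function.Injective t ∧ ∀ i, t i ∈ γ} :=
      fun e => ⟨fun i => (e i).1, fun i j h => e.injective (Subtype.ext h), fun i => (e i).2.1⟩
    have hf : Function.Injective f := fun e e' h => by
      ext i : 2
      exact congrFun (congrArg Subtype.val h) i
    rw [← hf.tsum_eq]
    · refine tsum_congr fun e => ?_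
      exact if_pos fun i => (e i).2.2
    · intro t ht
      have ht' : ∀ i, t.1 i ∈ B := by
        by_contra hc
        simp [hc] at ht
      refine ⟨⟨fun i => ⟨t.1 i, t.2.2 i, ht' i⟩, fun i j h => t.2.1 (congrArg Subtype.val h)⟩, rfl⟩
  rw [h1, tsum_fintype]
  simp only [Finset.sum_const, Finset.card_univ, nsmul_eq_mul, mul_one]
  rw [Fintype.card_embedding_eq, Fintype.card_fin, ← Nat.card_eq_fintype_card]
  rfl

/-- The correlation identity of order `m`. -/
def CorrId {n : ℕ} [MeasurableSpace (Config n)] (μ : Measure (Config n)) (m : ℕ)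
    (k : (Fin m → EuclideanSpace ℝ (Fin n)) → ℝ≥0∞) : Prop :=
  ∀ g : (Fin m → EuclideanSpace ℝ (Fin n)) → ℝ≥0∞, Measurable g →
    (∀ (pp : Equiv.Perm (Fin m)) t, g (t ∘ pp) = g t) →
    ∫⁻ γ : Config n, FF m g γ.1 ∂μ = ∫⁻ t, g t * k t

lemma star_add {n : ℕ} [MeasurableSpace (Config n)] {μ : Measure (Config n)} {m : ℕ}
    {k : (Fin m → EuclideanSpace ℝ (Fin n)) → ℝ≥0∞} (hc : CorrId μ m k)
    {g h h' : (Fin m → EuclideanSpace ℝ (Fin n)) → ℝ≥0∞}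
    (hh : Measurable h) (hh' : Measurable h')
    (hs : ∀ (pp : Equiv.Perm (Fin m)) t, h (t ∘ pp) = h t)
    (hs' : ∀ (pp : Equiv.Perm (Fin m)) t, h' (t ∘ pp) = h' t)
    (hfin : ∀ x, h x ≠ ∞) (hfin' : ∀ x, h' x ≠ ∞) (hg : ∀ t, g t = h t + h' t)
    (hintg : ∫⁻ t, g t * k t ≠ ∞)
    {φ φ' φ'' : Config n → ℝ≥0∞}
    (h1 : IsStar μ (fun γ => FF m h γ.1) φ) (h2 : IsStar μ (fun γ => FF m h' γ.1) φ')
    (h3 : IsStar μ (fun γ => FF m g γ.1) φ'') :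
    ∀ᵐ γ ∂μ, φ'' γ = φ γ + φ' γ := by
  obtain rfl : g = fun t => h t + h' t := funext hg
  have hle : (fun γ => φ γ + φ' γ) ≤ᵐ[μ] φ'' := by
    refine h3.max _ (h1.meas.add h2.meas) fun γ => ?_
    rw [FF_add]
    exact add_le_add (h1.le γ) (h2.le γ)
  have hc3 := hc (fun t => h t + h' t) (hh.add hh') (fun pp t => by simp only [hs, hs'])
  have hI : ∫⁻ γ, φ'' γ ∂μ = ∫⁻ γ, φ γ + φ' γ ∂μ := by
    rw [lintegral_add_left h1.meas, ← h1.lint, ← h2.lint, ← h3.lint, hc _ hh hs, hc _ hh' hs',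
      hc3, lintegral_add_mul k hh hh' hfin hfin']
  have := ae_eq_of_ae_le_of_lintegral_le hle (by
    rw [← hI, ← h3.lint, hc3]; exact hintg)
    h3.meas.aemeasurable hI.le
  filter_upwards [this] with γ hγ using hγ.symm

lemma le_left_of_add_le {a b a' b' : ℝ≥0∞} (c : ℝ≥0∞) (h : a + b ≤ a' + b' + c) (hb : b' ≤ b)
    (hfin : b' ≠ ∞) : a ≤ a' + c := by
  have : b' + a ≤ b' + (a' + c) := by
    calc b' + a ≤ b + a := by gcongr
      _ = a + b := add_comm _ _
      _ ≤ a' + b' + c := h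
      _ = _ := by ring
  exact (ENNReal.add_le_add_iff_left hfin).1 this

lemma trunc_bound {n : ℕ} [MeasurableSpace (Config n)] (μ : Measure (Config n))
    [IsProbabilityMeasure μ] (M : ℕ) (hM : 1 ≤ M)
    (k : (m : ℕ) → (Fin m → EuclideanSpace ℝ (Fin n)) → ℝ≥0∞)
    (K : ℝ≥0∞) (hK : K ≠ ∞)
    (hkbdd : ∀ m, 1 ≤ m → m ≤ M → ∀ᵐ t : Fin m → EuclideanSpace ℝ (Fin n), k m t ≤ K)
    (hcorr : ∀ m, 1 ≤ m → m ≤ M → CorrId μ m (k m))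
    (w : EuclideanSpace ℝ (Fin n) → ℝ≥0∞) (hw : Measurable w) (hw1 : ∀ x, w x ≤ 1)
    (hwint : ∫⁻ t : Fin 1 → EuclideanSpace ℝ (Fin n), w (t 0) ≠ ∞)
    (B : Set (EuclideanSpace ℝ (Fin n))) (hB : IsCompact B) (ε C : ℝ≥0∞)
    (hBw : ∀ x, x ∉ B → w x ≤ ε)
    (S : Finset ℕ) (hS : ∀ j ∈ S, 1 ≤ j ∧ j ≤ M)
    (h : (m : ℕ) → (Fin m → EuclideanSpace ℝ (Fin n)) → ℝ≥0∞)
    (hh : ∀ m, Measurable (h m)) (hh1 : ∀ m t, h m t ≤ 1)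
    (hsymm : ∀ m (pp : Equiv.Perm (Fin m)) t, h m (t ∘ pp) = h m t)
    (hhw : ∀ m ∈ S, ∀ t, h m t ≤ C * ∏ i, (w (t i)) ^ 2)
    (c : ℕ → ℝ≥0∞) (H : ℕ → Config n → ℝ≥0∞)
    (hH : ∀ j, IsStar μ (fun γ => FF j (h j) γ.1) (H j))
    (Gw : Config n → ℝ≥0∞) (hGw : IsStar μ (fun γ => FF 1 (fun t => w (t 0)) γ.1) Gw)
    (φ : Config n → ℝ≥0∞) (hφ : Measurable φ)
    (hφle : ∀ γ : Config n, φ γ ≤ ∑ j ∈ S, c j * FF j (h j) γ.1) :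
    ∀ᵐ γ ∂μ, φ γ ≤ ∑ j ∈ S, c j * (H j γ + C * ε * (Gw γ + 2⁻¹) ^ j) := by
  have hBm : MeasurableSet B := hB.measurableSet
  -- indicators
  let I : (m : ℕ) → (Fin m → EuclideanSpace ℝ (Fin n)) → ℝ≥0∞ :=
    fun m t => if ∀ i, t i ∈ B then 1 else 0
  have hIset : ∀ m, MeasurableSet {t : Fin m → EuclideanSpace ℝ (Fin n) | ∀ i, t i ∈ B} := by
    intro m
    have : {t : Fin m → EuclideanSpace ℝ (Fin n) | ∀ i, t i ∈ B} = Set.univ.pi fun _ => B := by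
      ext t; simp
    rw [this]
    exact MeasurableSet.univ_pi fun _ => hBm
  have hIm : ∀ m, Measurable (I m) := fun m =>
    Measurable.ite (hIset m) measurable_const measurable_const
  have hIs : ∀ m (pp : Equiv.Perm (Fin m)) t, I m (t ∘ pp) = I m t := by
    intro m pp t
    have : (∀ i, (t ∘ pp) i ∈ B) ↔ ∀ i, t i ∈ B := by
      constructor
      · intro h i; simpa using h (pp.symm i)
      · intro h i; exact h _
    simp only [I, this]
  have hI1 : ∀ m t, I m t ≤ 1 := fun m t => by
    simp only [I]; split_ifs <;> simp
  have hne : ∀ {a : ℝ≥0∞}, a ≤ 1 → a ≠ ∞ := fun h => (h.trans_lt ENNReal.one_lt_top).ne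
  have hIint : ∀ m, 1 ≤ m → m ≤ M → ∫⁻ t, I m t * k m t ≠ ∞ := by
    intro m h1 h2
    have : ∫⁻ t, I m t * k m t ≤ ∫⁻ t, I m t * K := by
      refine lintegral_mono_ae ?_
      filter_upwards [hkbdd m h1 h2] with t ht
      gcongr
    refine (this.trans_lt ?_).ne
    rw [lintegral_mul_const _ (hIm m)]
    refine ENNReal.mul_lt_top ?_ hK.lt_top
    have h3 : ∫⁻ t, I m t = volume {t : Fin m → EuclideanSpace ℝ (Fin n) | ∀ i, t i ∈ B} := by
      rw [← lintegral_indicator_one (hIset m)]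
      refine lintegral_congr fun t => ?_
      by_cases ht : ∀ i, t i ∈ B <;> simp [I, ht, Set.indicator]
    rw [h3]
    have : {t : Fin m → EuclideanSpace ℝ (Fin n) | ∀ i, t i ∈ B} = Set.univ.pi fun _ => B := by
      ext t; simp
    rw [this, volume_pi_pi]
    exact ENNReal.prod_lt_top fun _ _ => hB.measure_lt_top
  -- order one functional
  let g1 : (Fin 1 → EuclideanSpace ℝ (Fin n)) → ℝ≥0∞ := fun t => I 1 t + w (t 0)
  have hw1m : Measurable fun t : Fin 1 → EuclideanSpace ℝ (Fin n) => w (t 0) :=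
    hw.comp (measurable_pi_apply 0)
  have hw1s : ∀ (pp : Equiv.Perm (Fin 1)) (t : Fin 1 → EuclideanSpace ℝ (Fin n)),
      w ((t ∘ pp) 0) = w (t 0) := fun pp t => by
    simp only [Function.comp]; rw [Subsingleton.elim (pp 0) 0]
  have hwkint : ∫⁻ t : Fin 1 → EuclideanSpace ℝ (Fin n), w (t 0) * k 1 t ≠ ∞ := by
    have : ∫⁻ t : Fin 1 → EuclideanSpace ℝ (Fin n), w (t 0) * k 1 t ≤ ∫⁻ t : Fin 1 → EuclideanSpace ℝ (Fin n), w (t 0) * K := by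
      refine lintegral_mono_ae ?_
      filter_upwards [hkbdd 1 le_rfl hM] with t ht
      gcongr
    refine (this.trans_lt ?_).ne
    rw [lintegral_mul_const _ hw1m]
    exact ENNReal.mul_lt_top hwint.lt_top hK.lt_top
  have hg1int : ∫⁻ t, g1 t * k 1 t ≠ ∞ := by
    simp only [g1]
    rw [lintegral_add_mul _ (hIm 1) hw1m (fun t => hne (hI1 1 t)) (fun t => hne (hw1 _))]
    exact ENNReal.add_ne_top.2 ⟨hIint 1 le_rfl hM, hwkint⟩
  have hg1m : Measurable g1 := (hIm 1).add hw1m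
  have hg1s : ∀ (pp : Equiv.Perm (Fin 1)) t, g1 (t ∘ pp) = g1 t := fun pp t => by
    simp only [g1, hIs, hw1s]
  obtain ⟨G, hG⟩ := exists_isStar μ (fun γ : Config n => FF 1 g1 γ.1)
  obtain ⟨cB, hcB⟩ := exists_isStar μ (fun γ : Config n => FF 1 (I 1) γ.1)
  have hGsum := star_add (hcorr 1 le_rfl hM) (hIm 1) hw1m (hIs 1) hw1s
    (fun t => hne (hI1 1 t)) (fun t => hne (hw1 _)) (fun t => rfl) hg1int hcB hGw hG
  have hGfin : ∀ᵐ γ ∂μ, G γ ≠ ∞ := by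
    have : ∫⁻ γ, G γ ∂μ ≠ ∞ := by
      rw [← hG.lint, hcorr 1 le_rfl hM _ hg1m hg1s]; exact hg1int
    filter_upwards [ae_lt_top hG.meas this] with γ hγ using hγ.ne
  -- count
  have hcount : ∀ m (γ : Config n), FF m (I m) γ.1 =
      (((γ.1 ∩ B).ncard.descFactorial m : ℕ) : ℝ≥0∞) := fun m γ =>
    FF_indicator B m γ.1 (γ.2 B hB)
  let Cn : Config n → ℕ := fun γ => ⌈(cB γ).toReal⌉₊
  have hCnm : Measurable Cn := Nat.measurable_ceil.comp hcB.meas.ennreal_toReal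
  have hcBle : ∀ γ, cB γ ≤ ((γ.1 ∩ B).ncard : ℝ≥0∞) := fun γ => by
    have := hcB.le γ
    rw [hcount] at this
    simpa using this
  have hcBfin : ∀ γ, cB γ ≠ ∞ := fun γ => ((hcBle γ).trans_lt (ENNReal.natCast_lt_top _)).ne
  have hCnle : ∀ γ, Cn γ ≤ (γ.1 ∩ B).ncard := fun γ => by
    apply Nat.ceil_le.2
    have := ENNReal.toReal_mono (ENNReal.natCast_ne_top _) (hcBle γ)
    simpa using this
  have hA : ∀ᵐ γ ∂μ, FF 1 g1 γ.1 ≤ G γ + 2⁻¹ →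
      (γ.1 ∩ B).ncard = Cn γ ∧ FF 1 (fun t => w (t 0)) γ.1 ≤ Gw γ + 2⁻¹ := by
    filter_upwards [hGsum, hGfin] with γ h1 h2 h3
    rw [h1] at h2 h3
    have hGwf : Gw γ ≠ ∞ := (ENNReal.add_ne_top.1 h2).2
    simp only [g1] at h3
    rw [FF_add] at h3
    constructor
    · have h4 := le_left_of_add_le _ h3 (hGw.le γ) hGwf
      rw [hcount, Nat.descFactorial_one] at h4
      have h5 := ENNReal.toReal_mono (ENNReal.add_ne_top.2 ⟨hcBfin γ, by simp⟩) h4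
      rw [ENNReal.toReal_add (hcBfin γ) (by simp)] at h5
      simp only [ENNReal.toReal_natCast, ENNReal.toReal_inv, ENNReal.toReal_ofNat] at h5
      apply le_antisymm _ (hCnle γ)
      have h6 : (cB γ).toReal ≤ Cn γ := Nat.le_ceil _
      have h7 : ((γ.1 ∩ B).ncard : ℝ) < (Cn γ : ℝ) + 1 := by
        have : (2 : ℝ)⁻¹ < 1 := by norm_num
        linarith
      have h8 : (γ.1 ∩ B).ncard < Cn γ + 1 := by exact_mod_cast h7
      omega
    · rw [add_comm (FF 1 (I 1) γ.1), add_comm (cB γ)] at h3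
      exact le_left_of_add_le _ h3 (hcB.le γ) (hcBfin γ)
  -- truncated functionals agree with their stars
  have hT : ∀ j ∈ S, ∀ᵐ γ ∂μ, (γ.1 ∩ B).ncard = Cn γ →
      FF j (fun t => h j t * I j t) γ.1 ≤ H j γ := by
    intro j hj
    obtain ⟨hj1, hjM⟩ := hS j hj
    obtain ⟨φ1, hφ1⟩ := exists_isStar μ (fun γ : Config n => FF j (fun t => h j t * I j t) γ.1)
    obtain ⟨φ2, hφ2⟩ := exists_isStar μ (fun γ : Config n => FF j (fun t => (1 - h j t) * I j t) γ.1)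
    obtain ⟨φ3, hφ3⟩ := exists_isStar μ (fun γ : Config n => FF j (I j) γ.1)
    have hadd : ∀ t, I j t = h j t * I j t + (1 - h j t) * I j t := fun t => by
      rw [← add_mul, add_tsub_cancel_of_le (hh1 j t), one_mul]
    have hle1 : ∀ t, h j t * I j t ≤ 1 := fun t => mul_le_one' (hh1 j t) (hI1 j t)
    have hle2 : ∀ t, (1 - h j t) * I j t ≤ 1 := fun t => mul_le_one' tsub_le_self (hI1 j t)
    have hsum := star_add (hcorr j hj1 hjM) ((hh j).mul (hIm j))
      ((measurable_const.sub (hh j)).mul (hIm j))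
      (fun pp t => by simp only [Pi.mul_apply, hsymm, hIs]) (fun pp t => by simp [hsymm, hIs])
      (fun t => hne (hle1 t)) (fun t => hne (hle2 t)) hadd (hIint j hj1 hjM) hφ1 hφ2 hφ3
    have hC3 : (fun γ => (((Cn γ).descFactorial j : ℕ) : ℝ≥0∞)) ≤ᵐ[μ] φ3 := by
      refine hφ3.max _ ?_ fun γ => ?_
      · exact (measurable_from_nat (f := fun a : ℕ => ((a.descFactorial j : ℕ) : ℝ≥0∞))).comp hCnm
      · rw [hcount]
        exact_mod_cast Nat.descFactorial_le j (hCnle γ)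
    have h1H : φ1 ≤ᵐ[μ] H j := (hH j).max _ hφ1.meas fun γ => (hφ1.le γ).trans
      (FF_mono (fun t => mul_le_of_le_one_right' (hI1 j t)) _)
    filter_upwards [hsum, hC3, h1H] with γ e1 e2 e3 e4
    refine le_trans ?_ e3
    have e5 : FF j (I j) γ.1 ≤ φ3 γ := by rw [hcount, e4]; exact e2
    have e6 : FF j (I j) γ.1 = FF j (fun t => h j t * I j t) γ.1 +
        FF j (fun t => (1 - h j t) * I j t) γ.1 := by
      rw [← FF_add]; congr 1; funext t; exact hadd t
    rw [e6, e1] at e5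
    have hφ2fin : φ2 γ ≠ ∞ := by
      have : φ2 γ ≤ FF j (I j) γ.1 := (hφ2.le γ).trans (FF_mono (fun t => mul_le_of_le_one_left' tsub_le_self) _)
      rw [hcount] at this
      exact (this.trans_lt (ENNReal.natCast_lt_top _)).ne
    simpa using le_left_of_add_le 0 (by simpa using e5) (hφ2.le γ) hφ2fin
  have hT' := (Finset.eventually_all S).2 hT
  refine ae_of_dense hG hGfin hφ ?_ ?_
  · refine Finset.measurable_fun_sum _ fun j _ => ?_
    exact measurable_const.mul ((hH j).meas.add
      (measurable_const.mul ((hGw.meas.add measurable_const).pow_const j)))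
  · filter_upwards [hA, hT'] with γ a1 a2 a3
    obtain ⟨b1, b2⟩ := a1 a3
    refine (hφle γ).trans (Finset.sum_le_sum fun j hj => ?_)
    gcongr
    have hsplit : FF j (h j) γ.1 ≤ FF j (fun t => h j t * I j t) γ.1 +
        FF j (fun t => C * ε * ∏ i, w (t i)) γ.1 := by
      rw [← FF_add]
      refine FF_mono (fun t => ?_) _
      by_cases ht : ∀ i, t i ∈ B
      · simp [I, ht]
      · push Not at ht
        obtain ⟨i, hi⟩ := ht
        refine le_add_left ?_
        refine (hhw j hj t).trans ?_
        rw [mul_assoc]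
        gcongr
        rw [Finset.prod_pow, sq]
        gcongr
        calc ∏ i, w (t i) = w (t i) * ∏ i ∈ Finset.univ.erase i, w (t i) :=
              (Finset.mul_prod_erase _ (fun i => w (t i)) (Finset.mem_univ i)).symm
          _ ≤ w (t i) := mul_le_of_le_one_right' (Finset.prod_le_one' fun i _ => hw1 _)
          _ ≤ ε := hBw _ hi
    refine hsplit.trans (add_le_add (a2 j hj b1) ?_)
    rw [FF_const_mul]
    gcongr
    exact (FF_prod_le w j γ.1).trans (by gcongr)

lemma lintegral_exp_ne_top {n : ℕ} (δ : ℝ) (hδ : 0 < δ) :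
    ∫⁻ x : EuclideanSpace ℝ (Fin n), ENNReal.ofReal (rexp (-δ * ‖x‖)) ≠ ∞ := by
  have hintg := integrable_one_add_norm (E := EuclideanSpace ℝ (Fin n)) (μ := volume)
    (r := ((n + 1 : ℕ) : ℝ)) (by simp)
  have h2 : Integrable (fun x : EuclideanSpace ℝ (Fin n) => rexp (-δ * ‖x‖)) := by
    refine (hintg.const_mul (rexp δ * (n + 1).factorial / δ ^ (n + 1))).mono'
      (by fun_prop) (Filter.Eventually.of_forall fun x => ?_)
    rw [Real.norm_of_nonneg (Real.exp_nonneg _), Real.rpow_neg (by positivity), Real.rpow_natCast]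
    have h := Real.pow_div_factorial_le_exp (δ * (1 + ‖x‖)) (by positivity) (n + 1)
    have h3 : rexp (-δ * ‖x‖) = rexp δ / rexp (δ * (1 + ‖x‖)) := by
      rw [← Real.exp_sub]; congr 1; ring
    rw [h3, div_le_iff₀ (Real.exp_pos _)]
    calc rexp δ = (rexp δ * (n + 1).factorial / δ ^ (n + 1) * ((1 + ‖x‖) ^ (n + 1))⁻¹) *
          ((δ * (1 + ‖x‖)) ^ (n + 1) / (n + 1).factorial) := by
          have : (0 : ℝ) < 1 + ‖x‖ := by positivity
          rw [mul_pow]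
          field_simp
      _ ≤ _ := by gcongr
  exact h2.lintegral_lt_top.ne

lemma core_bound {n : ℕ} [MeasurableSpace (Config n)] (μ : Measure (Config n))
    [IsProbabilityMeasure μ] (M : ℕ) (hM : 1 ≤ M)
    (k : (m : ℕ) → (Fin m → EuclideanSpace ℝ (Fin n)) → ℝ≥0∞)
    (K : ℝ≥0∞) (hK : K ≠ ∞)
    (hkbdd : ∀ m, 1 ≤ m → m ≤ M → ∀ᵐ t : Fin m → EuclideanSpace ℝ (Fin n), k m t ≤ K)
    (hcorr : ∀ m, 1 ≤ m → m ≤ M → CorrId μ m (k m))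
    (δ : ℝ) (hδ : 0 < δ) (C : ℝ≥0∞) (hC : C ≠ ∞)
    (S : Finset ℕ) (hS : ∀ j ∈ S, 1 ≤ j ∧ j ≤ M)
    (h : (m : ℕ) → (Fin m → EuclideanSpace ℝ (Fin n)) → ℝ≥0∞)
    (hh : ∀ m, Measurable (h m)) (hh1 : ∀ m t, h m t ≤ 1)
    (hsymm : ∀ m (pp : Equiv.Perm (Fin m)) t, h m (t ∘ pp) = h m t)
    (hhw : ∀ m ∈ S, ∀ t, h m t ≤ C * ∏ i, (ENNReal.ofReal (rexp (-δ * ‖t i‖))) ^ 2)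
    (c : ℕ → ℝ≥0∞) (hc : ∀ j, c j ≠ ∞)
    (F : Config n → ℝ≥0∞)
    (hF : ∀ γ : Config n, F γ ≤ ∑ j ∈ S, c j * FF j (h j) γ.1) :
    ∫⁻ γ, F γ ∂μ ≤ ∑ j ∈ S, c j * (K * ∫⁻ t, h j t) := by
  obtain ⟨φ, hφ⟩ := exists_isStar μ F
  let w : EuclideanSpace ℝ (Fin n) → ℝ≥0∞ := fun x => ENNReal.ofReal (rexp (-δ * ‖x‖))
  have hwm : Measurable w := by fun_prop
  have hw1 : ∀ x, w x ≤ 1 := fun x => by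
    rw [ENNReal.ofReal_le_one, Real.exp_le_one_iff]
    have := mul_nonneg hδ.le (norm_nonneg x)
    linarith
  have hw1m : Measurable fun t : Fin 1 → EuclideanSpace ℝ (Fin n) => w (t 0) :=
    hwm.comp (measurable_pi_apply 0)
  have hwint : ∫⁻ t : Fin 1 → EuclideanSpace ℝ (Fin n), w (t 0) ≠ ∞ := by
    have := (volume_preserving_funUnique (Fin 1) (EuclideanSpace ℝ (Fin n))).lintegral_comp hwm
    have h2 : ∫⁻ t : Fin 1 → EuclideanSpace ℝ (Fin n), w (t 0) = ∫⁻ x, w x := this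
    rw [h2]
    exact lintegral_exp_ne_top δ hδ
  choose H hH using fun j => exists_isStar μ (fun γ : Config n => FF j (h j) γ.1)
  obtain ⟨Gw, hGw⟩ := exists_isStar μ
    (fun γ : Config n => FF 1 (fun t : Fin 1 → EuclideanSpace ℝ (Fin n) => w (t 0)) γ.1)
  have hGwfin : ∀ᵐ γ ∂μ, Gw γ < ∞ := by
    refine ae_lt_top hGw.meas ?_
    rw [← hGw.lint, hcorr 1 le_rfl hM _ hw1m (fun pp t => by
      simp only [Function.comp]; rw [Subsingleton.elim (pp 0) 0])]
    have : ∫⁻ t : Fin 1 → EuclideanSpace ℝ (Fin n), w (t 0) * k 1 t ≤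
        ∫⁻ t : Fin 1 → EuclideanSpace ℝ (Fin n), w (t 0) * K := by
      refine lintegral_mono_ae ?_
      filter_upwards [hkbdd 1 le_rfl hM] with t ht
      gcongr
    refine (this.trans_lt ?_).ne
    rw [lintegral_mul_const _ hw1m]
    exact ENNReal.mul_lt_top hwint.lt_top hK.lt_top
  have key : ∀ N : ℕ, ∀ᵐ γ ∂μ, φ γ ≤ ∑ j ∈ S, c j *
      (H j γ + C * ENNReal.ofReal (rexp (-δ * N)) * (Gw γ + 2⁻¹) ^ j) := by
    intro N
    refine trunc_bound μ M hM k K hK hkbdd hcorr w hwm hw1 hwint (Metric.closedBall 0 N)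
      (isCompact_closedBall 0 _) _ C ?_ S hS h hh hh1 hsymm hhw c H hH Gw hGw φ hφ.meas
      (fun γ => (hφ.le γ).trans (hF γ))
    intro x hx
    have hx' : (N : ℝ) < ‖x‖ := by simpa using hx
    apply ENNReal.ofReal_le_ofReal
    apply Real.exp_le_exp.2
    nlinarith
  have hlim : ∀ᵐ γ ∂μ, φ γ ≤ ∑ j ∈ S, c j * H j γ := by
    filter_upwards [ae_all_iff.2 key, hGwfin] with γ h1 h2
    have hε : Filter.Tendsto (fun N : ℕ => ENNReal.ofReal (rexp (-δ * N))) Filter.atTop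
        (nhds 0) := by
      rw [← ENNReal.ofReal_zero]
      refine ENNReal.tendsto_ofReal (Real.tendsto_exp_atBot.comp ?_)
      exact Filter.Tendsto.const_mul_atTop_of_neg (by linarith) tendsto_natCast_atTop_atTop
    have ht : Filter.Tendsto (fun N : ℕ => ∑ j ∈ S, c j *
      (H j γ + C * ENNReal.ofReal (rexp (-δ * N)) * (Gw γ + 2⁻¹) ^ j)) Filter.atTop
        (nhds (∑ j ∈ S, c j * (H j γ + C * 0 * (Gw γ + 2⁻¹) ^ j))) := by
      refine tendsto_finsetSum _ fun j _ => ?_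
      refine ENNReal.Tendsto.const_mul ?_ (Or.inr (hc j))
      refine tendsto_const_nhds.add ?_
      refine ENNReal.Tendsto.mul_const ?_ (Or.inr ?_)
      · exact ENNReal.Tendsto.const_mul hε (Or.inr hC)
      · exact ENNReal.pow_ne_top (ENNReal.add_ne_top.2 ⟨h2.ne, by simp⟩)
    simp only [mul_zero, zero_mul, add_zero] at ht
    exact ge_of_tendsto' ht h1
  rw [hφ.lint]
  calc ∫⁻ γ, φ γ ∂μ ≤ ∫⁻ γ, ∑ j ∈ S, c j * H j γ ∂μ := lintegral_mono_ae hlim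
    _ = ∑ j ∈ S, c j * ∫⁻ γ, H j γ ∂μ := by
      rw [lintegral_finsetSum _ fun j _ => (hH j).meas.const_mul _]
      exact Finset.sum_congr rfl fun j _ => lintegral_const_mul _ (hH j).meas
    _ ≤ _ := by
      refine Finset.sum_le_sum fun j hj => ?_
      gcongr
      obtain ⟨hj1, hj2⟩ := hS j hj
      rw [← (hH j).lint, hcorr j hj1 hj2 _ (hh j) (hsymm j), mul_comm K,
        ← lintegral_mul_const _ (hh j)]
      refine lintegral_mono_ae ?_
      filter_upwards [hkbdd j hj1 hj2] with t ht
      gcongr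

lemma inner_mult_le (N M : ℕ) (T : Finset (Fin N)) :
    ∑ k ∈ (Finset.piAntidiag (Finset.univ : Finset (Fin N)) (M - 1)).filter
        (fun k => Finset.univ.filter (fun i => k i ≠ 0) = T),
      Nat.multinomial Finset.univ k ≤ multCoeff M T.card := by
  let e : Fin T.card ≃ T := T.equivFin.symm
  let F : (Fin N → ℕ) → (Fin T.card → ℕ) := fun k i => k (e i)
  have hmem : ∀ k ∈ (Finset.piAntidiag (Finset.univ : Finset (Fin N)) (M - 1)).filter
        (fun k => Finset.univ.filter (fun i => k i ≠ 0) = T),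
      (∑ i, k i = M - 1) ∧ (∀ i, k i ≠ 0 ↔ i ∈ T) := by
    intro k hk
    rw [Finset.mem_filter, Finset.mem_piAntidiag] at hk
    refine ⟨hk.1.1, fun i => ?_⟩
    rw [← hk.2]; simp
  have hinj : Set.InjOn F ((Finset.piAntidiag (Finset.univ : Finset (Fin N)) (M - 1)).filter
        (fun k => Finset.univ.filter (fun i => k i ≠ 0) = T) : Finset (Fin N → ℕ)) := by
    intro k hk k' hk' hF
    have h1 := (hmem k hk).2
    have h2 := (hmem k' hk').2
    funext i
    by_cases hi : i ∈ T
    · have := congrFun hF (e.symm ⟨i, hi⟩)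
      simpa [F] using this
    · have a := (not_congr (h1 i)).2 hi
      have b := (not_congr (h2 i)).2 hi
      push Not at a b
      rw [a, b]
  have hterm : ∀ k ∈ (Finset.piAntidiag (Finset.univ : Finset (Fin N)) (M - 1)).filter
        (fun k => Finset.univ.filter (fun i => k i ≠ 0) = T),
      Nat.multinomial Finset.univ k = (M - 1).factorial / ∏ i, (F k i).factorial := by
    intro k hk
    obtain ⟨h1, h2⟩ := hmem k hk
    rw [Nat.multinomial, h1]
    congr 1
    have : ∏ i, (F k i).factorial = ∏ i : T, (k i).factorial :=
      e.prod_comp (fun i : T => (k i).factorial)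
    rw [this, Finset.prod_coe_sort T (fun i => (k i).factorial)]
    symm
    apply Finset.prod_subset (Finset.subset_univ T)
    intro i _ hi
    have a := (not_congr (h2 i)).2 hi
    push Not at a
    simp [a]
  rw [Finset.sum_congr rfl hterm, ← Finset.sum_image (f := fun i : Fin T.card → ℕ =>
    (M - 1).factorial / ∏ l, (i l).factorial) hinj]
  unfold multCoeff
  apply Finset.sum_le_sum_of_subset
  intro i hi
  rw [Finset.mem_image] at hi
  obtain ⟨k, hk, rfl⟩ := hi
  obtain ⟨h1, h2⟩ := hmem k hk
  rw [Finset.mem_filter, Finset.Nat.mem_antidiagonalTuple]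
  refine ⟨?_, fun l => Nat.pos_of_ne_zero ((h2 _).2 (e l).2)⟩
  have : ∑ i, F k i = ∑ i : T, k i := e.sum_comp (fun i : T => k i)
  rw [this, Finset.sum_coe_sort T k, ← h1]
  apply Finset.sum_subset (Finset.subset_univ T)
  intro i _ hi
  have a := (not_congr (h2 i)).2 hi
  push Not at a
  exact a

lemma pow_le_mult (N M : ℕ) (hM : 2 ≤ M) :
    N ^ (M - 1) ≤ ∑ j ∈ Finset.Icc 1 (M - 1), multCoeff M j * N.descFactorial j := by
  have h0 : N ^ (M - 1) = ∑ k ∈ Finset.piAntidiag (Finset.univ : Finset (Fin N)) (M - 1),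
      Nat.multinomial Finset.univ k := by
    have := Finset.sum_pow_eq_sum_piAntidiag (Finset.univ : Finset (Fin N)) (fun _ => (1 : ℕ)) (M - 1)
    simpa using this
  rw [h0, ← Finset.sum_fiberwise_of_maps_to (t := (Finset.univ : Finset (Fin N)).powerset)
    (g := fun k => Finset.univ.filter (fun i => k i ≠ 0)) (by intros; simp)]
  have h1 : ∀ T ∈ (Finset.univ : Finset (Fin N)).powerset,
      ∑ k ∈ (Finset.piAntidiag (Finset.univ : Finset (Fin N)) (M - 1)).filter
        (fun k => Finset.univ.filter (fun i => k i ≠ 0) = T), Nat.multinomial Finset.univ k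
      ≤ (fun j => if j ∈ Finset.Icc 1 (M - 1) then multCoeff M j else 0) T.card := by
    intro T _
    by_cases hT : T.card ∈ Finset.Icc 1 (M - 1)
    · simp only [hT, if_true]
      exact inner_mult_le N M T
    · simp only [hT, if_false]
      rw [Nat.le_zero, Finset.sum_eq_zero_iff]
      intro k hk
      exfalso
      apply hT
      rw [Finset.mem_filter, Finset.mem_piAntidiag] at hk
      obtain ⟨⟨hs, -⟩, hk2⟩ := hk
      rw [Finset.mem_Icc]
      constructor
      · rw [Nat.one_le_iff_ne_zero]
        intro hc
        rw [Finset.card_eq_zero] at hc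
        rw [hc, Finset.filter_eq_empty_iff] at hk2
        have : ∑ i, k i = 0 := Finset.sum_eq_zero fun i hi => by simpa using hk2 hi
        have h3 : M - 1 = 0 := hs.symm.trans this
        omega
      · rw [← hs, ← hk2, Finset.card_eq_sum_ones, Finset.sum_filter]
        refine Finset.sum_le_sum fun i _ => ?_
        split_ifs with h <;> omega
  refine (Finset.sum_le_sum h1).trans ?_
  rw [Finset.sum_powerset_apply_card
    (fun j => if j ∈ Finset.Icc 1 (M - 1) then multCoeff M j else 0)]
  simp only [Finset.card_univ, Fintype.card_fin, smul_eq_mul, mul_ite, mul_zero]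
  rw [← Finset.sum_filter]
  calc _ ≤ ∑ j ∈ Finset.Icc 1 (M - 1), N.choose j * multCoeff M j := by
        apply Finset.sum_le_sum_of_subset
        intro j hj
        exact (Finset.mem_filter.1 hj).2
    _ ≤ _ := by
      refine Finset.sum_le_sum fun j _ => ?_
      rw [mul_comm]
      gcongr
      rw [Nat.descFactorial_eq_factorial_mul_choose]
      exact Nat.le_mul_of_pos_left _ (Nat.factorial_pos _)

lemma confDegree_mono {n : ℕ} (γ : Config n) (R : ℝ) (hR : 0 < R)
    (x : EuclideanSpace ℝ (Fin n)) : confDegree γ.1 R x ≤ confDegree γ.1 (2 * R) x := by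
  refine Set.ncard_le_ncard (fun z hz => ⟨hz.1, hz.2.1, by linarith [hz.2.2]⟩) ?_
  refine (γ.2 _ (isCompact_closedBall x (2 * R))).subset fun z hz => ⟨hz.1, ?_⟩
  rw [Metric.mem_closedBall, dist_comm]; exact hz.2.2

lemma confDegree_nbr {n : ℕ} (γ : Config n) (R : ℝ) (hR : 0 < R)
    (x y : EuclideanSpace ℝ (Fin n)) (hy : y ∈ γ.1) (hxy : x ≠ y) (hd : dist x y ≤ R) :
    confDegree γ.1 R y ≤ confDegree γ.1 (2 * R) x := by
  have hfin : {z ∈ γ.1 | 0 < dist x z ∧ dist x z ≤ 2 * R}.Finite := by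
    refine (γ.2 _ (isCompact_closedBall x (2 * R))).subset fun z hz => ⟨hz.1, ?_⟩
    rw [Metric.mem_closedBall, dist_comm]; exact hz.2.2
  have hymem : y ∈ {z ∈ γ.1 | 0 < dist x z ∧ dist x z ≤ 2 * R} :=
    ⟨hy, dist_pos.2 hxy, by linarith⟩
  have hsub : {z ∈ γ.1 | 0 < dist y z ∧ dist y z ≤ R} ⊆
      insert x ({z ∈ γ.1 | 0 < dist x z ∧ dist x z ≤ 2 * R} \ {y}) := by
    intro z hz
    by_cases hzx : z = x
    · exact Or.inl hzx
    · refine Or.inr ⟨⟨hz.1, dist_pos.2 (Ne.symm hzx), ?_⟩, ?_⟩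
      · linarith [dist_triangle x y z, hz.2.2]
      · intro h
        have h' : z = y := h
        have := hz.2.1
        rw [h', dist_self] at this
        exact lt_irrefl _ this
  calc confDegree γ.1 R y ≤ _ := Set.ncard_le_ncard hsub ((hfin.sdiff).insert x)
    _ ≤ ({z ∈ γ.1 | 0 < dist x z ∧ dist x z ≤ 2 * R} \ {y}).ncard + 1 := Set.ncard_insert_le _ _
    _ = _ := Set.ncard_sdiff_singleton_add_one hymem hfin

/-- The punctured closed ball. -/
def nbrSet {n : ℕ} (R : ℝ) (x : EuclideanSpace ℝ (Fin n)) : Set (EuclideanSpace ℝ (Fin n)) :=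
  {z | 0 < dist x z ∧ dist x z ≤ R}

lemma FF_degree {n : ℕ} (γ : Config n) (R : ℝ) (x : EuclideanSpace ℝ (Fin n)) (m : ℕ) :
    FF m (fun t => if ∀ i, t i ∈ nbrSet R x then 1 else 0) γ.1
      = (((confDegree γ.1 R x).descFactorial m : ℕ) : ℝ≥0∞) := by
  have h : γ.1 ∩ nbrSet R x = {z ∈ γ.1 | 0 < dist x z ∧ dist x z ≤ R} := rfl
  have hfin : (γ.1 ∩ nbrSet R x).Finite := by
    refine (γ.2 _ (isCompact_closedBall x R)).subset fun z hz => ⟨hz.1, ?_⟩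
    rw [Metric.mem_closedBall, dist_comm]; exact hz.2.2
  exact FF_indicator _ m γ.1 hfin

/-- The rooted function with root index `i`. -/
noncomputable def rootFun {n : ℕ} (α R : ℝ) (m : ℕ) (i : Fin m)
    (t : Fin m → EuclideanSpace ℝ (Fin n)) : ℝ≥0∞ :=
  if ∀ l, dist (t i) (t l) ≤ 2 * R then ENNReal.ofReal (rexp (-α * ‖t i‖)) else 0

lemma tsum_root_le {n : ℕ} (γ : Config n) (α R : ℝ) (hR : 0 < R) (j : ℕ) :
    ∑' x : γ.1, ENNReal.ofReal (rexp (-α * ‖x.1‖)) *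
      (((confDegree γ.1 (2 * R) x.1).descFactorial j : ℕ) : ℝ≥0∞)
      ≤ FF (j + 1) (rootFun α R (j + 1) 0) γ.1 := by
  simp_rw [← FF_degree]
  unfold FF
  simp_rw [← ENNReal.tsum_mul_left]
  rw [← ENNReal.tsum_prod]
  let X := {t : Fin j → EuclideanSpace ℝ (Fin n) // Function.Injective t ∧ ∀ i, t i ∈ γ.1}
  let f : γ.1 × X → ℝ≥0∞ := fun p => ENNReal.ofReal (rexp (-α * ‖p.1.1‖)) *
    if ∀ i, p.2.1 i ∈ nbrSet (2 * R) p.1.1 then 1 else 0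
  let s : Set (γ.1 × X) := {p | ∀ i, p.2.1 i ∈ nbrSet (2 * R) p.1.1}
  have hsupp : Function.support f ⊆ s := by
    intro p hp
    by_contra hc
    apply hp
    simp only [f]
    have hc' : ¬ ∀ i, p.2.1 i ∈ nbrSet (2 * R) p.1.1 := hc
    simp only [hc', if_false, mul_zero]
  change ∑' p, f p ≤ _
  rw [← tsum_subtype_eq_of_support_subset hsupp]
  let F : s → {t : Fin (j + 1) → EuclideanSpace ℝ (Fin n) //
      Function.Injective t ∧ ∀ i, t i ∈ γ.1} := fun p =>
    ⟨Fin.cons p.1.1.1 p.1.2.1, by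
      rw [Fin.cons_injective_iff]
      refine ⟨?_, p.1.2.2.1⟩
      rintro ⟨i, hi⟩
      have := (p.2 i).1
      rw [hi, dist_self] at this
      exact lt_irrefl _ this, by
      intro i
      refine Fin.cases ?_ (fun i => ?_) i
      · exact p.1.1.2
      · exact p.1.2.2.2 i⟩
  have hF : Function.Injective F := by
    intro p p' h
    have h1 : (Fin.cons p.1.1.1 p.1.2.1 : Fin (j + 1) → EuclideanSpace ℝ (Fin n)) =
      Fin.cons p'.1.1.1 p'.1.2.1 := congrArg Subtype.val h
    have h2 := Fin.cons_injective2 h1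
    apply Subtype.ext
    exact Prod.ext (Subtype.ext h2.1) (Subtype.ext h2.2)
  refine le_trans (ENNReal.tsum_le_tsum fun p => ?_)
    (ENNReal.tsum_comp_le_tsum_of_injective hF (fun t => rootFun α R (j + 1) 0 t.1))
  have : ∀ l, dist ((F p).1 0) ((F p).1 l) ≤ 2 * R := by
    intro l
    refine Fin.cases ?_ (fun i => ?_) l
    · rw [dist_self]; positivity
    · exact (p.2 i).2
  simp only [rootFun]
  rw [if_pos this]
  exact mul_le_of_le_one_right' (by split_ifs <;> simp)

lemma aFun_le {n : ℕ} (γ : Config n) (M : ℕ) (hM : 2 ≤ M) (α R r : ℝ) (hR : 0 < R)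
    (hr : 0 ≤ r) (hrM : r ≤ M / 2 - 1) :
    aFun α R r γ.1 ≤ ∑ j ∈ Finset.Icc 1 (M - 1), (multCoeff M j : ℝ≥0∞) *
      FF (j + 1) (rootFun α R (j + 1) 0) γ.1 := by
  have h1 : ∀ x : γ.1, (∑' y : γ.1,
      if (x : EuclideanSpace ℝ (Fin n)) ≠ y ∧
        dist (x : EuclideanSpace ℝ (Fin n)) (y : EuclideanSpace ℝ (Fin n)) ≤ R
      then ENNReal.ofReal (rexp (-α * ‖(x : EuclideanSpace ℝ (Fin n))‖)) *
        ((confDegree γ.1 R x * confDegree γ.1 R y : ℕ) : ℝ≥0∞) ^ r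
      else 0) ≤ ENNReal.ofReal (rexp (-α * ‖x.1‖)) *
        ((confDegree γ.1 (2 * R) x.1 : ℕ) : ℝ≥0∞) ^ (M - 1) := by
    intro x
    set N := confDegree γ.1 (2 * R) x.1 with hN
    have hcount : (∑' y : γ.1, if 0 < dist x.1 y.1 ∧ dist x.1 y.1 ≤ 2 * R then (1 : ℝ≥0∞) else 0)
        = (N : ℝ≥0∞) := by
      have a := FF_degree γ (2 * R) x.1 1
      have b := FF_one (fun z : EuclideanSpace ℝ (Fin n) =>
        if 0 < dist x.1 z ∧ dist x.1 z ≤ 2 * R then (1 : ℝ≥0∞) else 0) γ.1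
      rw [← b]
      rw [Nat.descFactorial_one] at a
      rw [hN, ← a]
      congr 1
      funext t
      simp [nbrSet]
    calc _ ≤ ∑' y : γ.1, ENNReal.ofReal (rexp (-α * ‖x.1‖)) * (N : ℝ≥0∞) ^ (M - 2) *
          (if 0 < dist x.1 y.1 ∧ dist x.1 y.1 ≤ 2 * R then (1 : ℝ≥0∞) else 0) := by
          refine ENNReal.tsum_le_tsum fun y => ?_
          split_ifs with hc hc'
          · rw [mul_one]
            gcongr
            have a1 : confDegree γ.1 R x ≤ N := confDegree_mono γ R hR x
            have a2 : confDegree γ.1 R y ≤ N := confDegree_nbr γ R hR x y y.2 hc.1 hc.2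
            have hN1 : 1 ≤ N := by
              have hpos : y.1 ∈ {z ∈ γ.1 | 0 < dist x.1 z ∧ dist x.1 z ≤ 2 * R} := ⟨y.2, hc'⟩
              have hfin : {z ∈ γ.1 | 0 < dist x.1 z ∧ dist x.1 z ≤ 2 * R}.Finite := by
                refine (γ.2 _ (isCompact_closedBall x.1 (2 * R))).subset fun z hz => ⟨hz.1, ?_⟩
                rw [Metric.mem_closedBall, dist_comm]; exact hz.2.2
              exact (Set.ncard_pos hfin).2 ⟨_, hpos⟩
            calc ((confDegree γ.1 R x * confDegree γ.1 R y : ℕ) : ℝ≥0∞) ^ r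
                ≤ ((N * N : ℕ) : ℝ≥0∞) ^ r := by
                  apply ENNReal.rpow_le_rpow _ hr
                  exact_mod_cast Nat.mul_le_mul a1 a2
              _ = (N : ℝ≥0∞) ^ (2 * r) := by
                  rw [ENNReal.rpow_mul]
                  congr 1
                  push_cast
                  rw [ENNReal.rpow_ofNat, sq]
              _ ≤ (N : ℝ≥0∞) ^ (((M - 2 : ℕ) : ℝ)) := by
                  apply ENNReal.rpow_le_rpow_of_exponent_le
                  · exact_mod_cast hN1
                  · push_cast [Nat.cast_sub hM]; linarith
              _ = _ := ENNReal.rpow_natCast _ _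
          · exfalso
            apply hc'
            exact ⟨dist_pos.2 hc.1, by linarith [hc.2]⟩
          · exact zero_le
          · exact zero_le
      _ = ENNReal.ofReal (rexp (-α * ‖x.1‖)) * (N : ℝ≥0∞) ^ (M - 2) * N := by
          rw [ENNReal.tsum_mul_left, hcount]
      _ = _ := by
          rw [mul_assoc, ← pow_succ]
          congr 3
          omega
  unfold aFun
  calc _ ≤ ∑' x : γ.1, ENNReal.ofReal (rexp (-α * ‖x.1‖)) *
        ((confDegree γ.1 (2 * R) x.1 : ℕ) : ℝ≥0∞) ^ (M - 1) := ENNReal.tsum_le_tsum h1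
    _ ≤ ∑' x : γ.1, ∑ j ∈ Finset.Icc 1 (M - 1), (multCoeff M j : ℝ≥0∞) *
          (ENNReal.ofReal (rexp (-α * ‖x.1‖)) *
      (((confDegree γ.1 (2 * R) x.1).descFactorial j : ℕ) : ℝ≥0∞)) := by
        refine ENNReal.tsum_le_tsum fun x => ?_
        have := pow_le_mult (confDegree γ.1 (2 * R) x.1) M hM
        have h2 : ((confDegree γ.1 (2 * R) x.1 : ℕ) : ℝ≥0∞) ^ (M - 1) ≤
            ∑ j ∈ Finset.Icc 1 (M - 1), (multCoeff M j : ℝ≥0∞) *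
              (((confDegree γ.1 (2 * R) x.1).descFactorial j : ℕ) : ℝ≥0∞) := by
          exact_mod_cast this
        refine (mul_le_mul_right h2 _).trans ?_
        rw [Finset.mul_sum]
        exact Finset.sum_le_sum fun j _ => (mul_left_comm _ _ _).le
    _ = ∑ j ∈ Finset.Icc 1 (M - 1), (multCoeff M j : ℝ≥0∞) *
          ∑' x : γ.1, (ENNReal.ofReal (rexp (-α * ‖x.1‖)) *
      (((confDegree γ.1 (2 * R) x.1).descFactorial j : ℕ) : ℝ≥0∞)) := by
        rw [Summable.tsum_finsetSum fun _ _ => ENNReal.summable]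
        simp_rw [ENNReal.tsum_mul_left]
    _ ≤ _ := by
        refine Finset.sum_le_sum fun j _ => ?_
        gcongr
        exact tsum_root_le γ α R hR j

lemma rootFun_comp {n : ℕ} (α R : ℝ) (m : ℕ) (i : Fin m) (pp : Equiv.Perm (Fin m))
    (t : Fin m → EuclideanSpace ℝ (Fin n)) :
    rootFun α R m i (t ∘ pp) = rootFun α R m (pp i) t := by
  have : (∀ l, dist (t (pp i)) (t (pp l)) ≤ 2 * R) ↔ ∀ l, dist (t (pp i)) (t l) ≤ 2 * R := by
    constructor
    · intro h l; simpa using h (pp.symm l)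
    · intro h l; exact h _
  simp only [rootFun, Function.comp, this]

/-- Symmetrized rooted function. -/
noncomputable def symFun {n : ℕ} (α R : ℝ) (m : ℕ)
    (t : Fin m → EuclideanSpace ℝ (Fin n)) : ℝ≥0∞ :=
  (m : ℝ≥0∞)⁻¹ * ∑ i, rootFun α R m i t

lemma symFun_comp {n : ℕ} (α R : ℝ) (m : ℕ) (pp : Equiv.Perm (Fin m))
    (t : Fin m → EuclideanSpace ℝ (Fin n)) : symFun α R m (t ∘ pp) = symFun α R m t := by
  simp only [symFun, rootFun_comp]
  rw [Equiv.sum_comp pp (fun i => rootFun α R m i t)]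

lemma rootFun_le_one {n : ℕ} (α R : ℝ) (hα : 0 < α) (m : ℕ) (i : Fin m)
    (t : Fin m → EuclideanSpace ℝ (Fin n)) : rootFun α R m i t ≤ 1 := by
  unfold rootFun
  split_ifs
  · rw [ENNReal.ofReal_le_one, Real.exp_le_one_iff]
    have := mul_nonneg hα.le (norm_nonneg (t i))
    linarith
  · simp

lemma symFun_le {n : ℕ} (α R : ℝ) (m : ℕ) (t : Fin m → EuclideanSpace ℝ (Fin n)) (c : ℝ≥0∞)
    (h : ∀ i, rootFun α R m i t ≤ c) : symFun α R m t ≤ c := by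
  unfold symFun
  rcases Nat.eq_zero_or_pos m with rfl | hm
  · simp
  · calc (m : ℝ≥0∞)⁻¹ * ∑ i, rootFun α R m i t ≤ (m : ℝ≥0∞)⁻¹ * ∑ _i : Fin m, c := by
          gcongr; exact h _
      _ = c := by
          simp only [Finset.sum_const, Finset.card_univ, Fintype.card_fin, nsmul_eq_mul]
          rw [← mul_assoc, ENNReal.inv_mul_cancel (by exact_mod_cast hm.ne') (by simp), one_mul]

lemma rootFun_measurable {n : ℕ} (α R : ℝ) (m : ℕ) (i : Fin m) :
    Measurable (rootFun (n := n) α R m i) := by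
  unfold rootFun
  refine Measurable.ite ?_ (by fun_prop) measurable_const
  have : {t : Fin m → EuclideanSpace ℝ (Fin n) | ∀ l, dist (t i) (t l) ≤ 2 * R} =
      ⋂ l, {t | dist (t i) (t l) ≤ 2 * R} := by ext t; simp
  rw [this]
  refine MeasurableSet.iInter fun l => ?_
  exact (isClosed_le (by fun_prop) continuous_const).measurableSet

lemma symFun_measurable {n : ℕ} (α R : ℝ) (m : ℕ) :
    Measurable (symFun (n := n) α R m) := by
  unfold symFun
  exact measurable_const.mul (Finset.measurable_fun_sum _ fun i _ => rootFun_measurable α R m i)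

lemma FF_root_eq {n : ℕ} (α R : ℝ) (m : ℕ) (i i' : Fin m)
    (γ : Set (EuclideanSpace ℝ (Fin n))) :
    FF m (rootFun α R m i) γ = FF m (rootFun α R m i') γ := by
  let pp : Equiv.Perm (Fin m) := Equiv.swap i i'
  let e : {t : Fin m → EuclideanSpace ℝ (Fin n) // Function.Injective t ∧ ∀ i, t i ∈ γ} ≃
      {t : Fin m → EuclideanSpace ℝ (Fin n) // Function.Injective t ∧ ∀ i, t i ∈ γ} :=
    { toFun := fun t => ⟨t.1 ∘ pp, t.2.1.comp pp.injective, fun i => t.2.2 _⟩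
      invFun := fun t => ⟨t.1 ∘ pp, t.2.1.comp pp.injective, fun i => t.2.2 _⟩
      left_inv := fun t => by apply Subtype.ext; funext l; simp [pp]
      right_inv := fun t => by apply Subtype.ext; funext l; simp [pp] }
  unfold FF
  rw [← e.tsum_eq]
  refine tsum_congr fun t => ?_
  change rootFun α R m i (t.1 ∘ pp) = _
  rw [rootFun_comp]
  simp [pp]

lemma FF_sym {n : ℕ} (α R : ℝ) (m : ℕ) (i : Fin m)
    (γ : Set (EuclideanSpace ℝ (Fin n))) :
    FF m (symFun α R m) γ = FF m (rootFun α R m i) γ := by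
  have h1 : FF m (symFun α R m) γ = (m : ℝ≥0∞)⁻¹ * ∑ l, FF m (rootFun α R m l) γ := by
    unfold symFun
    rw [FF_const_mul]
    congr 1
    unfold FF
    rw [Summable.tsum_finsetSum fun _ _ => ENNReal.summable]
  rw [h1, Finset.sum_congr rfl fun l _ => FF_root_eq α R m l i γ]
  simp only [Finset.sum_const, Finset.card_univ, Fintype.card_fin, nsmul_eq_mul]
  have hm : m ≠ 0 := by rintro rfl; exact i.elim0
  rw [← mul_assoc, ENNReal.inv_mul_cancel (by exact_mod_cast hm) (by simp), one_mul]

lemma lintegral_root {n : ℕ} (α R : ℝ) (hR : 0 < R) (j : ℕ) (i : Fin (j + 1)) :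
    ∫⁻ t : Fin (j + 1) → EuclideanSpace ℝ (Fin n), rootFun α R (j + 1) i t =
      (volume (Metric.closedBall (0 : EuclideanSpace ℝ (Fin n)) (2 * R))) ^ j *
      ∫⁻ x : EuclideanSpace ℝ (Fin n), ENNReal.ofReal (rexp (-α * ‖x‖)) := by
  have hmp := (volume_preserving_piFinSuccAbove
    (fun _ : Fin (j + 1) => EuclideanSpace ℝ (Fin n)) i).symm
  rw [← hmp.lintegral_comp (rootFun_measurable α R (j + 1) i)]
  have hme : Measurable fun p : EuclideanSpace ℝ (Fin n) × (Fin j → EuclideanSpace ℝ (Fin n)) =>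
      rootFun α R (j + 1) i ((MeasurableEquiv.piFinSuccAbove
        (fun _ : Fin (j + 1) => EuclideanSpace ℝ (Fin n)) i).symm p) :=
    (rootFun_measurable α R (j + 1) i).comp (MeasurableEquiv.measurable _)
  rw [Measure.volume_eq_prod, lintegral_prod _ hme.aemeasurable]
  rw [mul_comm, ← lintegral_mul_const _ (by fun_prop)]
  refine lintegral_congr fun x => ?_
  have hset : MeasurableSet (Set.univ.pi fun _ : Fin j => Metric.closedBall x (2 * R)) :=
    MeasurableSet.univ_pi fun _ => Metric.isClosed_closedBall.measurableSet
  have h1 : ∀ z : Fin j → EuclideanSpace ℝ (Fin n),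
      rootFun α R (j + 1) i ((MeasurableEquiv.piFinSuccAbove
        (fun _ : Fin (j + 1) => EuclideanSpace ℝ (Fin n)) i).symm (x, z)) =
      ENNReal.ofReal (rexp (-α * ‖x‖)) *
        (Set.univ.pi fun _ : Fin j => Metric.closedBall x (2 * R)).indicator 1 z := by
    intro z
    have e1 : ((MeasurableEquiv.piFinSuccAbove
        (fun _ : Fin (j + 1) => EuclideanSpace ℝ (Fin n)) i).symm (x, z)) =
        i.insertNth (α := fun _ => EuclideanSpace ℝ (Fin n)) x z := rfl
    rw [e1]
    have e2 : (∀ l, dist (i.insertNth (α := fun _ => EuclideanSpace ℝ (Fin n)) x z i)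
        (i.insertNth (α := fun _ => EuclideanSpace ℝ (Fin n)) x z l) ≤ 2 * R) ↔
        z ∈ Set.univ.pi fun _ : Fin j => Metric.closedBall x (2 * R) := by
      rw [Fin.forall_iff_succAbove i]
      simp only [Fin.insertNth_apply_same, Fin.insertNth_apply_succAbove, dist_self, mem_pi,
        mem_univ, Metric.mem_closedBall, forall_true_left, dist_comm x]
      constructor
      · exact fun h => h.2
      · exact fun h => ⟨by positivity, h⟩
    unfold rootFun
    by_cases hz : z ∈ Set.univ.pi fun _ : Fin j => Metric.closedBall x (2 * R)
    · rw [if_pos (e2.2 hz), indicator_of_mem hz]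
      simp
    · rw [if_neg (fun h => hz (e2.1 h)), indicator_of_notMem hz, mul_zero]
  simp_rw [h1]
  rw [lintegral_const_mul _ (measurable_one.indicator hset), lintegral_indicator_one hset,
    volume_pi_pi]
  simp [Measure.addHaar_closedBall_center]

lemma lintegral_sym {n : ℕ} (α R : ℝ) (hR : 0 < R) (j : ℕ) :
    ∫⁻ t : Fin (j + 1) → EuclideanSpace ℝ (Fin n), symFun α R (j + 1) t =
      (volume (Metric.closedBall (0 : EuclideanSpace ℝ (Fin n)) (2 * R))) ^ j *
      ∫⁻ x : EuclideanSpace ℝ (Fin n), ENNReal.ofReal (rexp (-α * ‖x‖)) := by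
  unfold symFun
  rw [lintegral_const_mul _ (Finset.measurable_fun_sum _ fun i _ => rootFun_measurable α R _ i),
    lintegral_finsetSum _ fun i _ => rootFun_measurable α R _ i]
  simp_rw [lintegral_root α R hR]
  simp only [Finset.sum_const, Finset.card_univ, Fintype.card_fin, nsmul_eq_mul]
  rw [← mul_assoc, ENNReal.inv_mul_cancel (by simp) (by simp), one_mul]

lemma rootFun_le_prod {n : ℕ} (α R : ℝ) (hα : 0 < α) (hR : 0 < R) (M m : ℕ) (hmM : m ≤ M)
    (hM : 0 < M) (i : Fin m) (t : Fin m → EuclideanSpace ℝ (Fin n)) :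
    rootFun α R m i t ≤ ENNReal.ofReal (rexp (2 * α * R)) *
      ∏ l, (ENNReal.ofReal (rexp (-(α / (2 * M)) * ‖t l‖))) ^ 2 := by
  unfold rootFun
  split_ifs with h
  · have h1 : ∏ l, (ENNReal.ofReal (rexp (-(α / (2 * M)) * ‖t l‖))) ^ 2 =
        ENNReal.ofReal (rexp (∑ l, -(α / M) * ‖t l‖)) := by
      rw [Real.exp_sum, ENNReal.ofReal_prod_of_nonneg fun _ _ => Real.exp_nonneg _]
      refine Finset.prod_congr rfl fun l _ => ?_
      rw [← ENNReal.ofReal_pow (Real.exp_nonneg _), ← Real.exp_nat_mul]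
      congr 2
      have : (M : ℝ) ≠ 0 := by exact_mod_cast hM.ne'
      push_cast
      field_simp
    rw [h1, ← ENNReal.ofReal_mul (Real.exp_nonneg _), ← Real.exp_add]
    apply ENNReal.ofReal_le_ofReal
    apply Real.exp_le_exp.2
    have hM' : (0 : ℝ) < M := by exact_mod_cast hM
    have h2 : ∀ l, ‖t l‖ ≤ ‖t i‖ + 2 * R := fun l => by
      have a := h l
      rw [dist_comm, dist_eq_norm] at a
      have := norm_le_insert' (t l) (t i)
      linarith
    have h3 : ∑ l, (α / M) * ‖t l‖ ≤ α * (‖t i‖ + 2 * R) := by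
      calc ∑ l, (α / M) * ‖t l‖ ≤ ∑ _l : Fin m, (α / M) * (‖t i‖ + 2 * R) := by
            refine Finset.sum_le_sum fun l _ => ?_
            have := h2 l
            gcongr
        _ = (m : ℝ) * ((α / M) * (‖t i‖ + 2 * R)) := by simp
        _ ≤ (M : ℝ) * ((α / M) * (‖t i‖ + 2 * R)) := by
            have : (m : ℝ) ≤ M := by exact_mod_cast hmM
            gcongr
        _ = _ := by field_simp
    have h4 : ∑ l, -(α / M) * ‖t l‖ = -∑ l, (α / M) * ‖t l‖ := by
      rw [← Finset.sum_neg_distrib]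
      exact Finset.sum_congr rfl fun l _ => by ring
    rw [h4]
    linarith
  · exact zero_le


theorem stmt4 {n : ℕ} [MeasurableSpace (Config n)]
    (μ : Measure (Config n)) [IsProbabilityMeasure μ]
    (M : ℕ) (hM : 2 ≤ M)
    (k : (m : ℕ) → (Fin m → EuclideanSpace ℝ (Fin n)) → ℝ≥0∞)
    (K : ℝ) (hK : 0 ≤ K)
    (hkbdd : ∀ m, 1 ≤ m → m ≤ M → ∀ᵐ t : Fin m → EuclideanSpace ℝ (Fin n), k m t ≤ ENNReal.ofReal K)
    (hksymm : ∀ m, 1 ≤ m → m ≤ M → ∀ (pp : Equiv.Perm (Fin m)) (t : Fin m → EuclideanSpace ℝ (Fin n)),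
      k m (t ∘ pp) = k m t)
    (hcorr : ∀ m, 1 ≤ m → m ≤ M →
      ∀ g : (Fin m → EuclideanSpace ℝ (Fin n)) → ℝ≥0∞, Measurable g →
      (∀ (pp : Equiv.Perm (Fin m)) t, g (t ∘ pp) = g t) →
      ∫⁻ γ : Config n,
          (∑' t : {t : Fin m → EuclideanSpace ℝ (Fin n) //
              Function.Injective t ∧ ∀ i, t i ∈ γ.1}, g t.1) ∂μ
        = ∫⁻ t : Fin m → EuclideanSpace ℝ (Fin n), g t * k m t)
    (α R r : ℝ) (hα : 0 < α) (hR : 0 < R) (hr : 0 ≤ r) (hrM : r ≤ M / 2 - 1) :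
    ∫⁻ γ : Config n, aFun α R r γ.1 ∂μ
      ≤ ENNReal.ofReal K *
        (∑ j ∈ Finset.Icc 1 (M - 1), (multCoeff M j : ℝ≥0∞) *
          (volume (Metric.closedBall (0 : EuclideanSpace ℝ (Fin n)) (2 * R))) ^ j) *
        ∫⁻ x : EuclideanSpace ℝ (Fin n), ENNReal.ofReal (rexp (-α * ‖x‖)) := by
  have hcorr' : ∀ m, 1 ≤ m → m ≤ M → CorrId μ m (k m) := fun m h1 h2 g hg hs =>
    hcorr m h1 h2 g hg hs
  have hM0 : 0 < M := by omega
  have hmain := core_bound μ M (by omega) k (ENNReal.ofReal K) ENNReal.ofReal_ne_top hkbdd hcorr'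
    (α / (2 * M)) (by positivity) (ENNReal.ofReal (rexp (2 * α * R))) ENNReal.ofReal_ne_top
    ((Finset.Icc 1 (M - 1)).map (addRightEmbedding 1))
    (fun j hj => by
      simp only [Finset.mem_map, Finset.mem_Icc, addRightEmbedding_apply] at hj
      obtain ⟨a, ha, rfl⟩ := hj
      omega)
    (fun m => symFun α R m) (fun m => symFun_measurable α R m)
    (fun m t => symFun_le α R m t 1 fun i => rootFun_le_one α R hα m i t)
    (fun m pp t => symFun_comp α R m pp t)
    (fun m hm t => symFun_le α R m t _ fun i => by
      refine rootFun_le_prod α R hα hR M m ?_ hM0 i t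
      simp only [Finset.mem_map, Finset.mem_Icc, addRightEmbedding_apply] at hm
      obtain ⟨a, ha, rfl⟩ := hm
      omega)
    (fun j => (multCoeff M (j - 1) : ℝ≥0∞)) (fun j => ENNReal.natCast_ne_top _)
    (fun γ => aFun α R r γ.1)
    (fun γ => by
      rw [Finset.sum_map]
      simp only [addRightEmbedding_apply, Nat.add_sub_cancel]
      refine (aFun_le γ M hM α R r hR hr hrM).trans (Finset.sum_le_sum fun j _ => ?_)
      have h := FF_sym α R (j + 1) 0 γ.1
      change (multCoeff M j : ℝ≥0∞) * _ ≤ (multCoeff M j : ℝ≥0∞) * FF (j+1) (symFun α R (j+1)) γ.1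
      rw [h])
  refine hmain.trans (le_of_eq ?_)
  rw [Finset.sum_map, Finset.mul_sum, Finset.sum_mul]
  refine Finset.sum_congr rfl fun j _ => ?_
  simp only [addRightEmbedding_apply, Nat.add_sub_cancel]
  change (multCoeff M j : ℝ≥0∞) * (ENNReal.ofReal K *
    ∫⁻ t : Fin (j + 1) → EuclideanSpace ℝ (Fin n), symFun α R (j + 1) t) = _
  rw [lintegral_sym α R hR]
  ring
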